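/- Let n, m, k be positive integers with k ≤ n, let α > 1 be such that αm is an integer, and let δ ∈ (0,1). Let A be an (αm) × n random matrix whose entries are i.i.d., each equal to +1/√m or −1/√m with probability 1/2. Say that an m × n matrix B satisfies the (k, δ)-RIP if for every x ∈ ℝⁿ with at most k nonzero entries, (1−δ)‖x‖₂ ≤ ‖Bx‖₂ ≤ (1+δ)‖x‖₂. Then the probability that there exists some subset of m rows of A whose corresponding m × n submatrix fails the (k, δ)-RIP is at most 2·(12/δ)^k · C(n,k) · C(αm, m) · exp(−(m/2)·(δ²/8 − δ³/24)), where C(a,b) denotes the binomial coefficient. -/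

import Mathlib

open MeasureTheory

/-- The Euclidean norm of a vector in `ℝ^d`. -/
noncomputable def vecNorm {d : ℕ} (x : Fin d → ℝ) : ℝ :=
  Real.sqrt (∑ j, x j ^ 2)

/-- A matrix `B ∈ ℝ^{m×n}` satisfies the `(k, δ)`-restricted isometry
property if `(1−δ)‖x‖₂ ≤ ‖Bx‖₂ ≤ (1+δ)‖x‖₂` for every `k`-sparse `x`. -/
def SatisfiesRIP {m n : ℕ} (k : ℕ) (δ : ℝ) (B : Matrix (Fin m) (Fin n) ℝ) :
    Prop :=
  ∀ x : Fin n → ℝ, (Finset.univ.filter fun j => x j ≠ 0).card ≤ k →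
    (1 - δ) * vecNorm x ≤ vecNorm (B.mulVec x) ∧
      vecNorm (B.mulVec x) ≤ (1 + δ) * vecNorm x

/-- sign -/
def sgnB (b : Bool) : ℤ := if b then 1 else -1

/-- row sum -/
noncomputable def rowQ {n : ℕ} (v : Fin n → ℝ) (ρ : Fin n → Bool) : ℝ :=
  ∑ j, (sgnB (ρ j) : ℝ) * v j

lemma row_moments {n : ℕ} (v : Fin n → ℝ) :
    ∑ ρ : Fin n → Bool, (rowQ v ρ) ^ 2 = 2 ^ n * ∑ j, v j ^ 2 ∧
    ∑ ρ : Fin n → Bool, (rowQ v ρ) ^ 4 ≤ 2 ^ n * (3 * (∑ j, v j ^ 2) ^ 2) := by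
  induction n with
  | zero => simp [rowQ]
  | succ n ih =>
    obtain ⟨h2, h4⟩ := ih (fun j => v j.succ)
    have key : ∀ F : ℝ → ℝ, ∑ ρ : Fin (n+1) → Bool, F (rowQ v ρ) =
        ∑ ρ : Fin n → Bool, (F (v 0 + rowQ (fun j => v j.succ) ρ)
          + F (- v 0 + rowQ (fun j => v j.succ) ρ)) := by
      intro F
      rw [← (Fin.consEquiv (fun _ => Bool)).sum_comp, Fintype.sum_prod_type]
      simp [rowQ, Fin.consEquiv, Fin.sum_univ_succ, sgnB, Finset.sum_add_distrib]
    have k2 := key (fun x => x ^ 2)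
    have k4 := key (fun x => x ^ 4)
    have e2 : ∀ ρ : Fin n → Bool, (v 0 + rowQ (fun j => v j.succ) ρ) ^ 2
        + (- v 0 + rowQ (fun j => v j.succ) ρ) ^ 2
        = 2 * v 0 ^ 2 + 2 * rowQ (fun j => v j.succ) ρ ^ 2 := by intro ρ; ring
    have e4 : ∀ ρ : Fin n → Bool, (v 0 + rowQ (fun j => v j.succ) ρ) ^ 4
        + (- v 0 + rowQ (fun j => v j.succ) ρ) ^ 4
        = 2 * v 0 ^ 4 + 12 * v 0 ^ 2 * rowQ (fun j => v j.succ) ρ ^ 2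
          + 2 * rowQ (fun j => v j.succ) ρ ^ 4 := by intro ρ; ring
    simp only [e2] at k2
    simp only [e4] at k4
    rw [k2, k4]
    simp only [Finset.sum_add_distrib, ← Finset.mul_sum, h2, Fin.sum_univ_succ]
    simp only [Finset.sum_const, Finset.card_univ, Fintype.card_pi, Fintype.card_bool,
      Finset.prod_const, Fintype.card_fin, nsmul_eq_mul]
    push_cast
    set V := ∑ j : Fin n, v j.succ ^ 2
    constructor
    · ring
    · have : (0:ℝ) ≤ 2 ^ n * (v 0) ^ 4 := by positivity
      rw [pow_succ (2:ℝ) n]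
      nlinarith

lemma row_mgf {n : ℕ} (v : Fin n → ℝ) (t : ℝ) :
    ∑ ρ : Fin n → Bool, Real.exp (t * rowQ v ρ)
      ≤ 2 ^ n * Real.exp (t ^ 2 / 2 * ∑ j, v j ^ 2) := by
  have h1 : ∀ ρ : Fin n → Bool, Real.exp (t * rowQ v ρ)
      = ∏ j, Real.exp (t * ((sgnB (ρ j) : ℝ) * v j)) := by
    intro ρ
    rw [← Real.exp_sum, rowQ, Finset.mul_sum]
  simp only [h1]
  have h2 := Finset.prod_univ_sum (fun _ : Fin n => (Finset.univ : Finset Bool))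
    (fun j b => Real.exp (t * ((sgnB b : ℝ) * v j)))
  rw [Fintype.piFinset_univ] at h2
  rw [← h2]
  have h3 : (2:ℝ) ^ n * Real.exp (t ^ 2 / 2 * ∑ j, v j ^ 2)
      = ∏ j : Fin n, (2 * Real.exp ((t * v j) ^ 2 / 2)) := by
    rw [Finset.prod_mul_distrib, ← Real.exp_sum]
    simp only [Finset.prod_const, Finset.card_univ, Fintype.card_fin]
    congr 2
    rw [Finset.mul_sum]
    refine Finset.sum_congr rfl fun j _ => by ring
  rw [h3]
  refine Finset.prod_le_prod (fun j _ => by positivity) fun j _ => ?_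
  have := Real.cosh_le_exp_half_sq (t * v j)
  rw [Real.cosh_eq] at this
  simp [sgnB]
  linarith

lemma gauss_shift (t q : ℝ) :
    ∫ g : ℝ, Real.exp (-(1/2) * g ^ 2 + t * g * q)
      = Real.exp (t ^ 2 * q ^ 2 / 2) * Real.sqrt (2 * Real.pi) := by
  have h : ∀ g : ℝ, Real.exp (-(1/2) * g ^ 2 + t * g * q)
      = Real.exp (t ^ 2 * q ^ 2 / 2) * Real.exp (-(1/2) * (g - t * q) ^ 2) := by
    intro g; rw [← Real.exp_add]; congr 1; ring
  simp only [h]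
  rw [integral_const_mul, integral_sub_right_eq_self (fun g => Real.exp (-(1/2) * g ^ 2)),
    integral_gaussian]
  congr 2
  ring

lemma gauss_shift_int (t q : ℝ) :
    Integrable (fun g : ℝ => Real.exp (-(1/2) * g ^ 2 + t * g * q)) := by
  have h : ∀ g : ℝ, Real.exp (-(1/2) * g ^ 2 + t * g * q)
      = Real.exp (t ^ 2 * q ^ 2 / 2) * Real.exp (-(1/2) * (g - t * q) ^ 2) := by
    intro g; rw [← Real.exp_add]; congr 1; ring
  simp only [h]
  exact ((integrable_exp_neg_mul_sq (by norm_num : (0:ℝ) < 1/2)).comp_sub_right (t * q)).const_mul _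

lemma row_upper {n : ℕ} (v : Fin n → ℝ) (hv : ∑ j, v j ^ 2 = 1) (ε : ℝ) (hε : 0 ≤ ε) :
    ∑ ρ : Fin n → Bool, Real.exp (ε / (2 * (1 + ε)) * rowQ v ρ ^ 2)
      ≤ 2 ^ n * Real.sqrt (1 + ε) := by
  have hpos : 0 < 1 + ε := by linarith
  set t := Real.sqrt (ε / (1 + ε)) with ht
  have ht2 : t ^ 2 = ε / (1 + ε) := Real.sq_sqrt (by positivity)
  have hs : 0 < Real.sqrt (2 * Real.pi) := Real.sqrt_pos.2 (by positivity)
  refine le_of_mul_le_mul_right ?_ hs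
  calc (∑ ρ : Fin n → Bool, Real.exp (ε / (2 * (1 + ε)) * rowQ v ρ ^ 2)) * Real.sqrt (2 * Real.pi)
      = ∑ ρ : Fin n → Bool, ∫ g : ℝ, Real.exp (-(1/2) * g ^ 2 + t * g * rowQ v ρ) := by
        rw [Finset.sum_mul]
        refine Finset.sum_congr rfl fun ρ _ => ?_
        rw [gauss_shift, ht2]
        congr 2
        field_simp
    _ = ∫ g : ℝ, ∑ ρ : Fin n → Bool, Real.exp (-(1/2) * g ^ 2 + t * g * rowQ v ρ) := by
        rw [integral_finsetSum]
        intro ρ _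
        exact gauss_shift_int _ _
    _ ≤ ∫ g : ℝ, 2 ^ n * Real.exp (-(1 / (2 * (1 + ε))) * g ^ 2) := by
        refine integral_mono (integrable_finsetSum _ fun ρ _ => gauss_shift_int _ _)
          ((integrable_exp_neg_mul_sq (by positivity)).const_mul _) fun g => ?_
        have := row_mgf v (t * g)
        rw [hv, mul_pow, ht2] at this
        simp only [Real.exp_add, ← Finset.mul_sum]
        calc Real.exp (-(1/2) * g ^ 2) * ∑ ρ : Fin n → Bool, Real.exp (t * g * rowQ v ρ)
            ≤ Real.exp (-(1/2) * g ^ 2) * (2 ^ n * Real.exp (ε / (1 + ε) * g ^ 2 / 2 * 1)) := by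
              gcongr
          _ = 2 ^ n * Real.exp (-(1/2) * g ^ 2 + ε / (1 + ε) * g ^ 2 / 2 * 1) := by
              rw [Real.exp_add]; ring
          _ = _ := by
              congr 2
              field_simp
              ring
    _ = 2 ^ n * Real.sqrt (1 + ε) * Real.sqrt (2 * Real.pi) := by
        rw [integral_const_mul, integral_gaussian, mul_assoc, ← Real.sqrt_mul hpos.le]
        congr 2
        field_simp

lemma log_bound_up (ε : ℝ) (hε : 0 ≤ ε) (h1 : ε ≤ 1) :
    1 + ε ≤ Real.exp (ε - ε ^ 2 / 2 + ε ^ 3 / 3) := by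
  set z := ε - ε ^ 2 / 2 + ε ^ 3 / 3 with hz
  have hz0 : 0 ≤ z := by rw [hz]; nlinarith [pow_nonneg hε 3]
  have := Real.sum_le_exp_of_nonneg hz0 4
  simp [Finset.sum_range_succ, Nat.factorial] at this
  refine le_trans ?_ this
  have hzl : ε * (1 - ε / 2) ≤ z := by rw [hz]; nlinarith [pow_nonneg hε 3]
  have h3 : (ε * (1 - ε / 2)) ^ 3 ≤ z ^ 3 := by
    have : 0 ≤ ε * (1 - ε / 2) := by nlinarith
    gcongr
  have h4 : 0 ≤ ε ^ 4 * (1 - ε) := mul_nonneg (by positivity) (by linarith)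
  have h5 : 0 ≤ ε ^ 5 * (1 - ε) := mul_nonneg (by positivity) (by linarith)
  have h6 : 0 ≤ ε ^ 6 := by positivity
  have h7 : 0 ≤ ε ^ 4 := by positivity
  have e2 : z ^ 2 = ε^2 - ε^3 + 11/12 * ε^4 - ε^5/3 + ε^6/9 := by rw [hz]; ring
  rw [e2]
  nlinarith

lemma log_bound_low (u : ℝ) (hu : 0 ≤ u) (h1 : u < 1) :
    1 - u ≤ Real.exp (- u - u ^ 2 / 2 - u ^ 3 / 3) := by
  have h := Real.hasSum_pow_div_log_of_abs_lt_one (x := u) (by rwa [abs_of_nonneg hu])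
  have h2 := sum_le_hasSum (Finset.range 3) (fun i _ => by positivity) h
  simp [Finset.sum_range_succ] at h2
  rw [← Real.log_le_iff_le_exp (by linarith)]
  norm_num at h2
  linarith

lemma exp_neg_quad (y : ℝ) (hy : 0 ≤ y) : Real.exp (-y) ≤ 1 - y + y ^ 2 / 2 := by
  have h := Real.quadratic_le_exp_of_nonneg hy
  have hp := Real.exp_pos (-y)
  have he : Real.exp y * Real.exp (-y) = 1 := by rw [← Real.exp_add]; simp
  have hq : 0 ≤ 1 - y + y ^ 2 / 2 := by nlinarith [sq_nonneg (y - 1)]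
  have h3 : (1 - y + y ^ 2 / 2) * (1 + y + y ^ 2 / 2) ≤ (1 - y + y ^ 2 / 2) * Real.exp y :=
    mul_le_mul_of_nonneg_left h hq
  have h4 : 1 ≤ (1 - y + y ^ 2 / 2) * Real.exp y := by nlinarith [sq_nonneg (y^2)]
  nlinarith [mul_le_mul_of_nonneg_right h4 hp.le]

lemma row_upper' {n : ℕ} (v : Fin n → ℝ) (hv : ∑ j, v j ^ 2 = 1) (ε : ℝ) (hε : 0 ≤ ε)
    (h1 : ε ≤ 1/2) :
    ∑ ρ : Fin n → Bool, Real.exp (ε / (2 * (1 + ε)) * (rowQ v ρ ^ 2 - (1 + ε)))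
      ≤ 2 ^ n * Real.exp (-(1/2) * (ε ^ 2 / 2 - ε ^ 3 / 3)) := by
  have hpos : 0 < 1 + ε := by linarith
  have e : ∀ ρ : Fin n → Bool, Real.exp (ε / (2 * (1 + ε)) * (rowQ v ρ ^ 2 - (1 + ε)))
      = Real.exp (ε / (2 * (1 + ε)) * rowQ v ρ ^ 2) * Real.exp (-(ε / 2)) := by
    intro ρ
    rw [← Real.exp_add]; congr 1; field_simp; ring
  simp only [e, ← Finset.sum_mul]
  have hs : Real.sqrt (1 + ε) ≤ Real.exp ((ε - ε ^ 2 / 2 + ε ^ 3 / 3) / 2) := by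
    rw [Real.exp_half]
    exact Real.sqrt_le_sqrt (log_bound_up ε hε (by linarith))
  calc _ ≤ 2 ^ n * Real.sqrt (1 + ε) * Real.exp (-(ε / 2)) := by
        gcongr; exact row_upper v hv ε hε
    _ ≤ 2 ^ n * Real.exp ((ε - ε ^ 2 / 2 + ε ^ 3 / 3) / 2) * Real.exp (-(ε / 2)) := by gcongr
    _ = _ := by rw [mul_assoc, ← Real.exp_add]; congr 2; ring

lemma row_lower' {n : ℕ} (v : Fin n → ℝ) (hv : ∑ j, v j ^ 2 = 1) (ε : ℝ) (hε : 0 ≤ ε)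
    (h1 : ε ≤ 1/2) :
    ∑ ρ : Fin n → Bool, Real.exp (ε / 2 * ((1 - ε) - rowQ v ρ ^ 2))
      ≤ 2 ^ n * Real.exp (-(1/2) * (ε ^ 2 / 2 - ε ^ 3 / 3)) := by
  obtain ⟨h, rfl⟩ : ∃ h, ε = 2 * h := ⟨ε / 2, by ring⟩
  have h0 : 0 ≤ h := by linarith
  have h4 : h ≤ 1/4 := by linarith
  obtain ⟨m2, m4⟩ := row_moments v
  rw [hv] at m2 m4
  have e : ∀ ρ : Fin n → Bool, Real.exp (2 * h / 2 * ((1 - 2 * h) - rowQ v ρ ^ 2))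
      ≤ (1 - h * rowQ v ρ ^ 2 + h ^ 2 / 2 * rowQ v ρ ^ 4) * Real.exp (h * (1 - 2 * h)) := by
    intro ρ
    have := exp_neg_quad (h * rowQ v ρ ^ 2) (by positivity)
    calc _ = Real.exp (-(h * rowQ v ρ ^ 2)) * Real.exp (h * (1 - 2 * h)) := by
          rw [← Real.exp_add]; congr 1; ring
      _ ≤ _ := by
          gcongr
          refine this.trans (le_of_eq ?_)
          ring
  refine (Finset.sum_le_sum fun ρ _ => e ρ).trans ?_
  rw [← Finset.sum_mul, Finset.sum_add_distrib, Finset.sum_sub_distrib, ← Finset.mul_sum,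
    ← Finset.mul_sum, m2]
  simp only [Finset.sum_const, Finset.card_univ, Fintype.card_pi, Fintype.card_bool,
      Finset.prod_const, Fintype.card_fin, nsmul_eq_mul]
  push_cast
  have hu := log_bound_low (h - 3/2 * h ^ 2) (by nlinarith) (by nlinarith)
  set u := h - 3/2 * h ^ 2 with hu'
  calc _ ≤ 2 ^ n * (1 - u) * Real.exp (h * (1 - 2 * h)) := by
        gcongr
        have := mul_le_mul_of_nonneg_left m4 (by positivity : 0 ≤ h ^ 2 / 2)
        rw [hu']
        linarith
    _ ≤ 2 ^ n * Real.exp (- u - u ^ 2 / 2 - u ^ 3 / 3) * Real.exp (h * (1 - 2 * h)) := by gcongr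
    _ = 2 ^ n * Real.exp (- u - u ^ 2 / 2 - u ^ 3 / 3 + h * (1 - 2 * h)) := by
        rw [mul_assoc, ← Real.exp_add]
    _ ≤ _ := by
        gcongr
        have h3 : 0 ≤ h ^ 3 * (1/6 - 3/8 * h + 9/4 * h^2 - 9/8 * h^3) := by
          refine mul_nonneg (by positivity) ?_
          nlinarith [sq_nonneg h, mul_nonneg (sq_nonneg h) h0]
        have : -(1/2) * ((2*h) ^ 2 / 2 - (2*h) ^ 3 / 3) - (- u - u ^ 2 / 2 - u ^ 3 / 3 + h * (1 - 2 * h))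
          = h ^ 3 * (1/6 - 3/8 * h + 9/4 * h^2 - 9/8 * h^3) := by rw [hu']; ring
        linarith

lemma sep_card {E : Type*} [NormedAddCommGroup E] [NormedSpace ℝ E] [FiniteDimensional ℝ E]
    (r : ℝ) (hr : 0 < r) (hr1 : r ≤ 1)
    (s : Finset E) (hs : ∀ c ∈ s, ‖c‖ = 1)
    (h : ∀ c ∈ s, ∀ d ∈ s, c ≠ d → r ≤ ‖c - d‖) :
    (s.card : ℝ) ≤ (3 / r) ^ Module.finrank ℝ E := by
  borelize E
  let μ : Measure E := Measure.addHaar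
  have hr2 : 0 < r / 2 := by positivity
  have ρpos : 0 < 1 + r / 2 := by positivity
  set A := ⋃ c ∈ s, Metric.ball (c : E) (r / 2) with hA
  have D : Set.Pairwise (s : Set E) (Function.onFun Disjoint fun c => Metric.ball (c : E) (r / 2)) := by
    rintro c hc d hd hcd
    apply Metric.ball_disjoint_ball
    rw [dist_eq_norm]
    have := h c hc d hd hcd
    linarith
  have A_subset : A ⊆ Metric.ball (0 : E) (1 + r / 2) := by
    refine Set.iUnion₂_subset fun x hx => ?_
    apply Metric.ball_subset_ball'
    rw [dist_zero_right, hs x hx]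
    linarith
  have I :
    (s.card : ENNReal) * ENNReal.ofReal ((r/2) ^ Module.finrank ℝ E) * μ (Metric.ball 0 1) ≤
      ENNReal.ofReal ((1 + r/2) ^ Module.finrank ℝ E) * μ (Metric.ball 0 1) :=
    calc
      _ = μ A := by
        rw [hA, measure_biUnion_finset D fun c _ => measurableSet_ball]
        simp only [μ.addHaar_ball_of_pos _ hr2]
        simp only [Finset.sum_const, nsmul_eq_mul, mul_assoc]
      _ ≤ μ (Metric.ball (0 : E) (1 + r / 2)) := measure_mono A_subset
      _ = _ := by
        simp only [μ.addHaar_ball_of_pos _ ρpos]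
  have J : (s.card : ENNReal) * ENNReal.ofReal ((r/2) ^ Module.finrank ℝ E)
      ≤ ENNReal.ofReal ((1 + r/2) ^ Module.finrank ℝ E) :=
    (ENNReal.mul_le_mul_iff_left (Metric.measure_ball_pos _ _ zero_lt_one).ne'
      measure_ball_lt_top.ne).1 I
  have K := ENNReal.toReal_le_of_le_ofReal (pow_nonneg ρpos.le _) J
  rw [ENNReal.toReal_mul, ENNReal.toReal_natCast, ENNReal.toReal_ofReal (by positivity)] at K
  have : (1 + r / 2) ^ Module.finrank ℝ E ≤ (3 / r) ^ Module.finrank ℝ E * (r/2) ^ Module.finrank ℝ E := by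
    rw [← mul_pow]
    refine pow_le_pow_left₀ ρpos.le ?_ _
    field_simp
    linarith
  exact le_of_mul_le_mul_right (K.trans this) (by positivity)

lemma exists_net {E : Type*} [NormedAddCommGroup E] [NormedSpace ℝ E] [FiniteDimensional ℝ E]
    (r : ℝ) (hr : 0 < r) (hr1 : r ≤ 1) :
    ∃ s : Finset E, (∀ c ∈ s, ‖c‖ = 1) ∧ (s.card : ℝ) ≤ (3 / r) ^ Module.finrank ℝ E ∧
      ∀ x : E, ‖x‖ = 1 → ∃ c ∈ s, ‖x - c‖ ≤ r := by
  classical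
  let P : ℕ → Prop := fun N => ∃ s : Finset E, s.card = N ∧ (∀ c ∈ s, ‖c‖ = 1) ∧
    (∀ c ∈ s, ∀ d ∈ s, c ≠ d → r ≤ ‖c - d‖)
  let b := ⌊(3 / r) ^ Module.finrank ℝ E⌋₊
  have hb : ∀ N, P N → N ≤ b := by
    rintro N ⟨s, rfl, h1, h2⟩
    exact Nat.le_floor (sep_card r hr hr1 s h1 h2)
  have h0 : P 0 := ⟨∅, by simp⟩
  obtain ⟨s, hc, h1, h2⟩ := Nat.findGreatest_spec (P := P) (Nat.zero_le b) h0
  refine ⟨s, h1, sep_card r hr hr1 s h1 h2, fun x hx => ?_⟩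
  by_contra! hcon
  have hxs : x ∉ s := fun hxs => by
    have := hcon x hxs
    simp at this
    linarith
  have : P (s.card + 1) := by
    refine ⟨insert x s, Finset.card_insert_of_notMem hxs, ?_, ?_⟩
    · intro c hc
      rcases Finset.mem_insert.1 hc with rfl | hc
      · exact hx
      · exact h1 c hc
    · intro c hc d hd hcd
      rcases Finset.mem_insert.1 hc with rfl | hc' <;> rcases Finset.mem_insert.1 hd with rfl | hd'
      · exact absurd rfl hcd
      · exact (hcon d hd').le
      · rw [norm_sub_rev]; exact (hcon c hc').le
      · exact h2 c hc' d hd' hcd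
  have h3 := Nat.le_findGreatest (hb _ this) this
  omega

lemma net_rip {E F : Type*} [NormedAddCommGroup E] [NormedSpace ℝ E]
    [NormedAddCommGroup F] [NormedSpace ℝ F] (L : E →L[ℝ] F) (δ : ℝ) (h0 : 0 < δ) (h1 : δ < 1)
    (s : Finset E) (hs : ∀ x : E, ‖x‖ = 1 → ∃ c ∈ s, ‖x - c‖ ≤ δ / 4)
    (hL : ∀ c ∈ s, 1 - δ / 2 ≤ ‖L c‖ ∧ ‖L c‖ ≤ 1 + δ / 2) (x : E) :
    (1 - δ) * ‖x‖ ≤ ‖L x‖ ∧ ‖L x‖ ≤ (1 + δ) * ‖x‖ := by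
  have hn : ‖L‖ ≤ (1 + δ / 2) + ‖L‖ * (δ / 4) := by
    refine ContinuousLinearMap.opNorm_le_of_unit_norm (by positivity) fun x hx => ?_
    obtain ⟨c, hc, hxc⟩ := hs x hx
    have e : L x = L c + L (x - c) := by simp
    calc ‖L x‖ ≤ ‖L c‖ + ‖L (x - c)‖ := by rw [e]; exact norm_add_le _ _
      _ ≤ (1 + δ / 2) + ‖L‖ * (δ / 4) := by
        gcongr
        · exact (hL c hc).2
        · exact (L.le_opNorm _).trans (by gcongr)
  have hn' : ‖L‖ ≤ 1 + δ := by nlinarith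
  refine ⟨?_, (L.le_opNorm x).trans (by gcongr)⟩
  have unit : ∀ x : E, ‖x‖ = 1 → 1 - δ ≤ ‖L x‖ := by
    intro x hx
    obtain ⟨c, hc, hxc⟩ := hs x hx
    have e : L c = L x - L (x - c) := by simp
    have : ‖L c‖ ≤ ‖L x‖ + ‖L‖ * (δ / 4) := by
      rw [e]
      exact (norm_sub_le _ _).trans (by gcongr; exact (L.le_opNorm _).trans (by gcongr))
    have h2 := (hL c hc).1
    nlinarith
  rcases eq_or_ne x 0 with rfl | hx
  · simp
  have hx' : 0 < ‖x‖ := norm_pos_iff.2 hx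
  have := unit (‖x‖⁻¹ • x) (by rw [norm_smul]; simp [hx'.ne'])
  rw [map_smul, norm_smul, norm_inv, norm_norm] at this
  calc (1 - δ) * ‖x‖ ≤ (‖x‖⁻¹ * ‖L x‖) * ‖x‖ := by gcongr
    _ = ‖L x‖ := by field_simp

/-- sign measure -/
noncomputable abbrev sgnMeas : Measure ℤ :=
  (PMF.uniformOfFinset ({-1, 1} : Finset ℤ) (by simp)).toMeasure

lemma pi_sgn_eq (ι : Type*) [Fintype ι] [DecidableEq ι] :
    Measure.pi (fun _ : ι => sgnMeas) =
      ∑ σ : ι → Bool, ((2 : ENNReal)⁻¹ ^ Fintype.card ι) •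
        Measure.dirac (fun i => sgnB (σ i)) := by
  classical
  refine Measure.pi_eq fun s hs => ?_
  have h1 : ∀ t : Set ℤ, sgnMeas t = ∑ b : Bool, (2:ENNReal)⁻¹ * t.indicator 1 (sgnB b) := by
    intro t
    rw [sgnMeas, PMF.toMeasure_apply_eq_tsum,
      tsum_eq_sum (s := ({-1, 1} : Finset ℤ)) (by
        intro b hb
        rw [Set.indicator_apply_eq_zero]
        intro _
        exact PMF.uniformOfFinset_apply_of_notMem _ hb)]
    rw [Finset.sum_pair (by norm_num)]
    simp [sgnB, Set.indicator_apply, add_comm, PMF.uniformOfFinset_apply]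
  simp only [h1]
  rw [Finset.prod_univ_sum, Fintype.piFinset_univ, Measure.finsetSum_apply]
  refine Finset.sum_congr rfl fun σ _ => ?_
  rw [Measure.smul_apply, Measure.dirac_apply' _ (MeasurableSet.univ_pi hs),
    Finset.prod_mul_distrib, smul_eq_mul]
  congr 1
  · simp [Finset.card_univ]
  · simp only [Set.indicator_apply, Set.mem_univ_pi, Pi.one_apply]
    rw [Finset.prod_ite_zero]
    simp

lemma chernoff {N n : ℕ} (S : Finset (Fin N)) (f : (Fin n → Bool) → ℝ)
    (hf : ∀ ρ, 0 ≤ f ρ) (c : ℝ) (hc : ∑ ρ, f ρ ≤ 2 ^ n * c) :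
    ∑ σ : Fin N × Fin n → Bool, ∏ i ∈ S, f (fun j => σ (i, j)) ≤ 2 ^ (N * n) * c ^ S.card := by
  classical
  have h1 : ∑ σ : Fin N × Fin n → Bool, ∏ i ∈ S, f (fun j => σ (i, j))
      = ∑ τ : Fin N → Fin n → Bool, ∏ i, (if i ∈ S then f (τ i) else 1) := by
    refine Fintype.sum_equiv (Equiv.curry _ _ _) _ _ fun σ => ?_
    rw [Finset.prod_ite_mem, Finset.univ_inter]
    rfl
  have h2 := Finset.prod_univ_sum (fun _ : Fin N => (Finset.univ : Finset (Fin n → Bool)))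
    (fun i ρ => if i ∈ S then f ρ else 1)
  rw [Fintype.piFinset_univ] at h2
  rw [h1, ← h2]
  have h3 : (2:ℝ) ^ (N * n) * c ^ S.card = ∏ i : Fin N, (2 ^ n * if i ∈ S then c else 1) := by
    rw [Finset.prod_mul_distrib, Finset.prod_ite_mem]
    simp [pow_mul, mul_comm N n]
  rw [h3]
  refine Finset.prod_le_prod (fun i _ => Finset.sum_nonneg fun ρ _ => by split_ifs; exacts [hf ρ, zero_le_one])
    fun i _ => ?_
  split_ifs
  · exact hc
  · simp

/-- bad event for a net point -/
def badSet {N n : ℕ} (S : Finset (Fin N)) (v : Fin n → ℝ) (ε : ℝ) : Set (Fin N × Fin n → ℤ) :=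
  {s | ¬ ((S.card : ℝ) * (1 - ε) ≤ ∑ i ∈ S, (∑ j, (s (i, j) : ℝ) * v j) ^ 2 ∧
    ∑ i ∈ S, (∑ j, (s (i, j) : ℝ) * v j) ^ 2 ≤ (S.card : ℝ) * (1 + ε))}

lemma bad_count {N n : ℕ} (S : Finset (Fin N)) (v : Fin n → ℝ) (hv : ∑ j, v j ^ 2 = 1)
    (ε : ℝ) (h0 : 0 ≤ ε) (h1 : ε ≤ 1 / 2) :
    ∑ σ : Fin N × Fin n → Bool, (badSet S v ε).indicator (1 : (Fin N × Fin n → ℤ) → ℝ) (fun p => sgnB (σ p))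
      ≤ 2 ^ (N * n) * (2 * Real.exp (-((S.card : ℝ) / 2) * (ε ^ 2 / 2 - ε ^ 3 / 3))) := by
  have u := chernoff S (fun ρ => Real.exp (ε / (2 * (1 + ε)) * (rowQ v ρ ^ 2 - (1 + ε))))
    (fun _ => (Real.exp_pos _).le) _ (row_upper' v hv ε h0 h1)
  have l := chernoff S (fun ρ => Real.exp (ε / 2 * ((1 - ε) - rowQ v ρ ^ 2)))
    (fun _ => (Real.exp_pos _).le) _ (row_lower' v hv ε h0 h1)
  have e : Real.exp (-(1/2) * (ε ^ 2 / 2 - ε ^ 3 / 3)) ^ S.card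
      = Real.exp (-((S.card : ℝ) / 2) * (ε ^ 2 / 2 - ε ^ 3 / 3)) := by
    rw [← Real.exp_nat_mul]; congr 1; ring
  rw [e] at u l
  refine le_trans ?_ ((add_le_add u l).trans (le_of_eq (by ring)))
  rw [← Finset.sum_add_distrib]
  refine Finset.sum_le_sum fun σ _ => ?_
  simp only [← Real.exp_sum, ← Finset.mul_sum, Finset.sum_sub_distrib, Finset.sum_const,
    nsmul_eq_mul]
  by_cases hb : (fun p => sgnB (σ p)) ∈ badSet S v ε
  · rw [Set.indicator_of_mem hb]
    have hb' := hb
    simp only [badSet, Set.mem_ofPred_eq, not_and_or, not_le] at hb'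
    simp only [rowQ, Pi.one_apply]
    rcases hb' with h | h
    · refine le_add_of_nonneg_of_le (Real.exp_pos _).le (Real.one_le_exp ?_)
      exact mul_nonneg (by positivity) (by linarith)
    · refine le_add_of_le_of_nonneg (Real.one_le_exp ?_) (Real.exp_pos _).le
      exact mul_nonneg (by positivity) (by linarith)
  · rw [Set.indicator_of_notMem hb]
    positivity

lemma bad_measure {N n : ℕ} (S : Finset (Fin N)) (v : Fin n → ℝ) (hv : ∑ j, v j ^ 2 = 1)
    (ε : ℝ) (h0 : 0 ≤ ε) (h1 : ε ≤ 1 / 2) :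
    Measure.pi (fun _ : Fin N × Fin n => sgnMeas) (badSet S v ε)
      ≤ ENNReal.ofReal (2 * Real.exp (-((S.card : ℝ) / 2) * (ε ^ 2 / 2 - ε ^ 3 / 3))) := by
  have hm : MeasurableSet (badSet S v ε) := Set.Countable.measurableSet (Set.to_countable _)
  rw [pi_sgn_eq, Measure.finsetSum_apply]
  simp only [Measure.smul_apply, Measure.dirac_apply' _ hm, smul_eq_mul]
  rw [← Finset.mul_sum]
  have h := bad_count S v hv ε h0 h1
  have e : ∑ σ : Fin N × Fin n → Bool, (badSet S v ε).indicator (1 : (Fin N × Fin n → ℤ) → ENNReal) (fun p => sgnB (σ p))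
    = ENNReal.ofReal (∑ σ : Fin N × Fin n → Bool,
        (badSet S v ε).indicator (1 : (Fin N × Fin n → ℤ) → ℝ) (fun p => sgnB (σ p))) := by
    rw [ENNReal.ofReal_sum_of_nonneg (fun _ _ => Set.indicator_nonneg (by simp) _)]
    refine Finset.sum_congr rfl fun σ _ => ?_
    by_cases hb : (fun p => sgnB (σ p)) ∈ badSet S v ε <;> simp [hb]
  rw [e]
  have e2 : ((2 : ENNReal)⁻¹ ^ Fintype.card (Fin N × Fin n)) = ENNReal.ofReal ((2 ^ (N * n))⁻¹) := by
    rw [ENNReal.ofReal_inv_of_pos (by positivity), ENNReal.ofReal_pow (by norm_num)]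
    simp [ENNReal.inv_pow]
  rw [e2, ← ENNReal.ofReal_mul (by positivity)]
  refine ENNReal.ofReal_le_ofReal ?_
  rw [inv_mul_le_iff₀ (by positivity)]
  exact h

lemma supp_sum {n : ℕ} (T : Finset (Fin n)) (f : Fin n → ℝ) (hf : ∀ j, j ∉ T → f j = 0) :
    ∑ j, f j = ∑ j : T, f j := by
  rw [Finset.sum_coe_sort T f]
  exact (Finset.sum_subset (Finset.subset_univ T) fun j _ hj => hf j hj).symm

/-- extension by zero -/
noncomputable def extZ {n : ℕ} (T : Finset (Fin n)) (y : EuclideanSpace ℝ T) (j : Fin n) : ℝ :=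
  if h : j ∈ T then y ⟨j, h⟩ else 0

lemma extZ_of {n : ℕ} (T : Finset (Fin n)) (y : EuclideanSpace ℝ T) (j : T) :
    extZ T y j = y j := by
  simp [extZ]

lemma extZ_not {n : ℕ} (T : Finset (Fin n)) (y : EuclideanSpace ℝ T) (j : Fin n) (h : j ∉ T) :
    extZ T y j = 0 := by
  simp [extZ, h]

lemma extZ_norm {n : ℕ} (T : Finset (Fin n)) (y : EuclideanSpace ℝ T) :
    ∑ j, extZ T y j ^ 2 = ‖y‖ ^ 2 := by
  rw [supp_sum T _ (fun j hj => by simp [extZ_not T y j hj]), EuclideanSpace.norm_sq_eq]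
  simp [extZ_of]

/-- restricted operator -/
noncomputable def restrOp {N n : ℕ} (S : Finset (Fin N)) (T : Finset (Fin n))
    (a : Fin N → Fin n → ℝ) : EuclideanSpace ℝ T →L[ℝ] EuclideanSpace ℝ S :=
  LinearMap.toContinuousLinearMap
    { toFun := fun y => WithLp.toLp 2 fun i : S => ∑ j : T, a i j * y j
      map_add' := fun x y => by
        ext i; simp [mul_add, Finset.sum_add_distrib]
      map_smul' := fun c y => by
        ext i; simp only [PiLp.smul_apply, smul_eq_mul, RingHom.id_apply, Finset.mul_sum]
        refine Finset.sum_congr rfl fun j _ => by ring }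

lemma restrOp_norm {N n : ℕ} (S : Finset (Fin N)) (T : Finset (Fin n))
    (a : Fin N → Fin n → ℝ) (y : EuclideanSpace ℝ T) :
    ‖restrOp S T a y‖ ^ 2 = ∑ i ∈ S, (∑ j, a i j * extZ T y j) ^ 2 := by
  rw [EuclideanSpace.norm_sq_eq, ← Finset.sum_coe_sort S]
  refine Finset.sum_congr rfl fun i _ => ?_
  rw [supp_sum T _ (fun j hj => by simp [extZ_not T y j hj])]
  simp [restrOp, extZ_of]

lemma rip_of_good {N n m : ℕ} (hm : 0 < m) (S : Finset (Fin N)) (hS : S.card = m)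
    (T : Finset (Fin n)) (δ : ℝ) (h0 : 0 < δ) (h1 : δ < 1)
    (Q : Finset (EuclideanSpace ℝ T))
    (hQ : ∀ x : EuclideanSpace ℝ T, ‖x‖ = 1 → ∃ c ∈ Q, ‖x - c‖ ≤ δ / 4)
    (s : Fin N × Fin n → ℤ) (hs : ∀ q ∈ Q, s ∉ badSet S (extZ T q) (δ / 2))
    (x : Fin n → ℝ) (hx : ∀ j, j ∉ T → x j = 0) :
    (1 - δ) * Real.sqrt (∑ j, x j ^ 2) ≤
        Real.sqrt (∑ i ∈ S, (∑ j, (s (i, j) : ℝ) / Real.sqrt m * x j) ^ 2) ∧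
      Real.sqrt (∑ i ∈ S, (∑ j, (s (i, j) : ℝ) / Real.sqrt m * x j) ^ 2) ≤
        (1 + δ) * Real.sqrt (∑ j, x j ^ 2) := by
  have hm' : (0 : ℝ) < m := by exact_mod_cast hm
  set a : Fin N → Fin n → ℝ := fun i j => (s (i, j) : ℝ) / Real.sqrt m with ha
  set y : EuclideanSpace ℝ T := WithLp.toLp 2 fun j : T => x j with hy
  have hxy : extZ T y = x := by
    ext j
    by_cases hj : j ∈ T
    · simp [extZ, hj, hy]
    · rw [extZ_not T y j hj, hx j hj]
  have key := net_rip (restrOp S T a) δ h0 h1 Q hQ (fun q hq => by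
    have hq' := hs q hq
    simp only [badSet, Set.mem_ofPred_eq, not_not] at hq'
    have e : ∑ i ∈ S, (∑ j, a i j * extZ T q j) ^ 2
        = (∑ i ∈ S, (∑ j, (s (i, j) : ℝ) * extZ T q j) ^ 2) / m := by
      rw [Finset.sum_div]
      refine Finset.sum_congr rfl fun i _ => ?_
      rw [← Real.sq_sqrt hm'.le, ← div_pow, Finset.sum_div]
      congr 1
      refine Finset.sum_congr rfl fun j _ => ?_
      rw [ha]; ring
    have hn := restrOp_norm S T a q
    rw [e] at hn
    rw [hS] at hq'
    have l : 1 - δ / 2 ≤ ‖restrOp S T a q‖ ^ 2 := by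
      rw [hn, le_div_iff₀ hm']; linarith [hq'.1]
    have u : ‖restrOp S T a q‖ ^ 2 ≤ 1 + δ / 2 := by
      rw [hn, div_le_iff₀ hm']; linarith [hq'.2]
    have nn := norm_nonneg (restrOp S T a q)
    constructor
    · by_contra! hc
      nlinarith
    · by_contra! hc
      nlinarith) y
  have e1 : ‖y‖ = Real.sqrt (∑ j, x j ^ 2) := by
    rw [← hxy, extZ_norm, Real.sqrt_sq (norm_nonneg _)]
  have e2 : ‖restrOp S T a y‖ = Real.sqrt (∑ i ∈ S, (∑ j, a i j * x j) ^ 2) := by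
    rw [← hxy, ← restrOp_norm, Real.sqrt_sq (norm_nonneg _)]
  rw [e1, e2] at key
  exact key

/-- **RIP for all `m`-row submatrices of a random sign matrix (union bound).**
Let `A` be an `(αm) × n` random matrix with i.i.d. entries `±1/√m`. The
probability that some `m × n` submatrix formed by `m` of its rows fails the
`(k, δ)`-RIP is at most
`2·(12/δ)^k·C(n,k)·C(αm,m)·exp(−(m/2)(δ²/8 − δ³/24))`. -/
theorem rip_all_submatrices_union_bound
    (n m k : ℕ) (hn : 0 < n) (hm : 0 < m) (hk : 0 < k) (hkn : k ≤ n)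
    (α : ℝ) (hα : 1 < α) (N : ℕ) (hN : (N : ℝ) = α * (m : ℝ))
    (δ : ℝ) (hδ0 : 0 < δ) (hδ1 : δ < 1) :
    (Measure.pi fun _ : Fin N × Fin n =>
        (PMF.uniformOfFinset ({-1, 1} : Finset ℤ) (by simp)).toMeasure)
      {s : Fin N × Fin n → ℤ |
        ∃ g : Fin m → Fin N, Function.Injective g ∧
          ¬ SatisfiesRIP k δ
              (Matrix.of fun i j => (s (g i, j) : ℝ) / Real.sqrt m)}
      ≤ ENNReal.ofReal
          (2 * (12 / δ) ^ k * (n.choose k : ℝ) * (N.choose m : ℝ) *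
            Real.exp (-((m : ℝ) / 2) * (δ ^ 2 / 8 - δ ^ 3 / 24))) := by
  classical
  have hN1 : ∀ T : Finset (Fin n), ∃ Q : Finset (EuclideanSpace ℝ T), (∀ c ∈ Q, ‖c‖ = 1) ∧
      (Q.card : ℝ) ≤ (12 / δ) ^ T.card ∧
      ∀ x : EuclideanSpace ℝ T, ‖x‖ = 1 → ∃ c ∈ Q, ‖x - c‖ ≤ δ / 4 := by
    intro T
    obtain ⟨Q, h1, h2, h3⟩ := exists_net (E := EuclideanSpace ℝ T) (δ / 4) (by positivity)
      (by linarith)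
    refine ⟨Q, h1, h2.trans (le_of_eq ?_), h3⟩
    rw [finrank_euclideanSpace, Fintype.card_coe]
    congr 1
    field_simp
    norm_num
  choose Q hQ1 hQ2 hQ3 using hN1
  set b : ℝ := 2 * Real.exp (-((m : ℝ) / 2) * (δ ^ 2 / 8 - δ ^ 3 / 24)) with hb
  have hb0 : 0 ≤ b := by positivity
  have hsub : {s : Fin N × Fin n → ℤ |
        ∃ g : Fin m → Fin N, Function.Injective g ∧
          ¬ SatisfiesRIP k δ
              (Matrix.of fun i j => (s (g i, j) : ℝ) / Real.sqrt m)} ⊆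
      ⋃ S ∈ Finset.powersetCard m (Finset.univ : Finset (Fin N)),
        ⋃ T ∈ Finset.powersetCard k (Finset.univ : Finset (Fin n)),
          ⋃ q ∈ Q T, badSet S (extZ T q) (δ / 2) := by
    rintro s ⟨g, hg, hrip⟩
    by_contra hcon
    simp only [Set.mem_iUnion, not_exists, Finset.mem_powersetCard, Finset.subset_univ,
      true_and] at hcon
    refine hrip fun x hx => ?_
    obtain ⟨T, hT, hTk⟩ := Finset.exists_superset_card_eq hx (by simpa using hkn)
    have hSc : (Finset.univ.image g).card = m := by
      rw [Finset.card_image_of_injective _ hg]; simp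
    have key := rip_of_good hm (Finset.univ.image g) hSc T δ hδ0 hδ1 (Q T) (hQ3 T) s
      (hcon _ hSc T hTk) x (fun j hj => by
        by_contra hne
        exact hj (hT (by simp [hne])))
    rw [Finset.sum_image (fun _ _ _ _ h => hg h)] at key
    simpa [vecNorm, Matrix.mulVec, dotProduct] using key
  refine (measure_mono hsub).trans ?_
  have hT : ∀ S ∈ Finset.powersetCard m (Finset.univ : Finset (Fin N)),
      ∀ T ∈ Finset.powersetCard k (Finset.univ : Finset (Fin n)),
      Measure.pi (fun _ : Fin N × Fin n => sgnMeas) (⋃ q ∈ Q T, badSet S (extZ T q) (δ / 2))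
        ≤ ENNReal.ofReal ((12 / δ) ^ k * b) := by
    intro S hS T hT
    have hS' := (Finset.mem_powersetCard.1 hS).2
    have hT' := (Finset.mem_powersetCard.1 hT).2
    have hq : ∀ q ∈ Q T, Measure.pi (fun _ : Fin N × Fin n => sgnMeas)
        (badSet S (extZ T q) (δ / 2)) ≤ ENNReal.ofReal b := by
      intro q hq
      have := bad_measure S (extZ T q) (by rw [extZ_norm, hQ1 T q hq]; norm_num) (δ / 2)
        (by linarith) (by linarith)
      rw [hS'] at this
      refine this.trans (le_of_eq ?_)
      rw [hb]
      congr 4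
      ring
    refine (measure_biUnion_finset_le _ _).trans ((Finset.sum_le_sum hq).trans ?_)
    rw [Finset.sum_const, nsmul_eq_mul, ← ENNReal.ofReal_natCast,
      ← ENNReal.ofReal_mul (by positivity)]
    refine ENNReal.ofReal_le_ofReal ?_
    have := hQ2 T
    rw [hT'] at this
    gcongr
  have hS : ∀ S ∈ Finset.powersetCard m (Finset.univ : Finset (Fin N)),
      Measure.pi (fun _ : Fin N × Fin n => sgnMeas)
        (⋃ T ∈ Finset.powersetCard k (Finset.univ : Finset (Fin n)),
          ⋃ q ∈ Q T, badSet S (extZ T q) (δ / 2))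
        ≤ ENNReal.ofReal ((n.choose k : ℝ) * ((12 / δ) ^ k * b)) := by
    intro S hS
    refine (measure_biUnion_finset_le _ _).trans ((Finset.sum_le_sum (hT S hS)).trans ?_)
    rw [Finset.sum_const, nsmul_eq_mul, ← ENNReal.ofReal_natCast,
      ← ENNReal.ofReal_mul (by positivity), Finset.card_powersetCard, Finset.card_univ,
      Fintype.card_fin]
  refine (measure_biUnion_finset_le _ _).trans ((Finset.sum_le_sum hS).trans ?_)
  rw [Finset.sum_const, nsmul_eq_mul, ← ENNReal.ofReal_natCast,
    ← ENNReal.ofReal_mul (by positivity), Finset.card_powersetCard, Finset.card_univ,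
    Fintype.card_fin]
  refine ENNReal.ofReal_le_ofReal (le_of_eq ?_)
  rw [hb]
  ring
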